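/- arXiv:1705.10033 — 7 statements merged into one kernel-verified Lean document; each statement's English description precedes it below -/
import Mathlib

section
/- Let k ≥ 2, σ > 0, and let μ_1, …, μ_k be real numbers with μ_1 > μ_i for every i ≠ 1. Let w = (w_1, …, w_k) with w_i ∈ (0,1) for all i and w_1 + … + w_k = 1. For each n ≥ 1 and each i let T_{n,i} ≥ 1 be a positive integer and μ_{n,i} a real number, and suppose that T_{n,i}/n → w_i and μ_{n,i} → μ_i as n → ∞, for every i. Then the posterior probability of incorrect selection satisfies lim_{n→∞} −(1/n) log(1 − α_{n,1}) = min_{i≠1} (μ_i − μ_1)² / (2σ²(1/w_i + 1/w_1)). -/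
open MeasureTheory ProbabilityTheory Filter

/-- The posterior probability that arm `0` (the "first" arm) has the largest mean, under a
product Gaussian posterior whose `i`-th marginal is `N(m i, σ² / T i)`. -/
noncomputable def alphaBest (k : ℕ) [NeZero k] (σ : ℝ) (m : Fin k → ℝ) (T : Fin k → ℕ) : ℝ :=
  ((Measure.pi fun i => gaussianReal (m i) (Real.toNNReal (σ ^ 2 / (T i : ℝ))))
    {θ : Fin k → ℝ | ∀ i, i ≠ 0 → θ i < θ 0}).toReal

/-- Chernoff bound for the mass a Gaussian with nonpositive mean puts on the half-line `[0, ∞)`. -/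
lemma gaussianReal_real_Ici_zero_le {d : ℝ} {v : NNReal} (hd : d ≤ 0) (hv : v ≠ 0) :
    (gaussianReal d v).real (Set.Ici 0) ≤ Real.exp (-(d ^ 2 / (2 * v))) := by
  have hv' : (0 : ℝ) < v := by positivity
  have h := measure_ge_le_exp_mul_mgf (μ := gaussianReal d v) (X := id) (t := -d / v) 0
    (div_nonneg (by linarith) hv'.le) (integrable_exp_mul_gaussianReal _)
  rw [mgf_id_gaussianReal] at h
  refine h.trans_eq ?_
  rw [← Real.exp_add]
  congr 1
  field_simp
  ring

/-- Lower bound for the mass a Gaussian with nonpositive mean puts on the half-line `[0, ∞)`. -/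
lemma le_gaussianReal_real_Ici_zero {d : ℝ} {v : NNReal} (hd : d ≤ 0) (hv : v ≠ 0) :
    (√(2 * Real.pi))⁻¹ * Real.exp (-((√v - d) ^ 2 / (2 * v)))
      ≤ (gaussianReal d v).real (Set.Ici 0) := by
  have hv' : (0 : ℝ) < v := by positivity
  have hs : 0 < √(v : ℝ) := Real.sqrt_pos.2 hv'
  calc _ = √(v : ℝ) * gaussianPDFReal d v √v := by
        rw [gaussianPDFReal, Real.sqrt_mul (by positivity) (v : ℝ), neg_div]
        field_simp
    _ = ∫ _ in Set.Icc 0 √(v : ℝ), gaussianPDFReal d v √v := by simp [hs.le]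
    _ ≤ ∫ x in Set.Icc 0 √(v : ℝ), gaussianPDFReal d v x := by
        refine setIntegral_mono_on (by simp) (integrable_gaussianPDFReal d v).integrableOn
          measurableSet_Icc fun x hx => ?_
        obtain ⟨h0, h1⟩ := hx
        have : (x - d) ^ 2 ≤ (√(v : ℝ) - d) ^ 2 := by
          apply pow_le_pow_left₀ <;> linarith
        simp only [gaussianPDFReal]
        gcongr
    _ = (gaussianReal d v).real (Set.Icc 0 √(v : ℝ)) := by
        rw [measureReal_def, gaussianReal_apply_eq_integral d hv, ENNReal.toReal_ofReal]
        exact integral_nonneg fun x => gaussianPDFReal_nonneg d v x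
    _ ≤ _ := measureReal_mono Set.Icc_subset_Ici_self

/-- Under a product Gaussian measure, a difference of two coordinates is Gaussian. -/
lemma pi_gaussianReal_map_sub {ι : Type*} [Fintype ι] (m : ι → ℝ) (v : ι → NNReal) {i j : ι}
    (hij : i ≠ j) :
    (Measure.pi fun l => gaussianReal (m l) (v l)).map (fun θ => θ i - θ j)
      = gaussianReal (m i - m j) (v i + v j) := by
  set P := Measure.pi fun l => gaussianReal (m l) (v l) with hP
  have hind : iIndepFun (fun l (θ : ι → ℝ) => θ l) P :=
    iIndepFun_pi (X := fun _ => id) fun _ => aemeasurable_id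
  have hmap (l : ι) : P.map (fun θ => θ l) = gaussianReal (m l) (v l) :=
    (measurePreserving_eval _ l).map_eq
  have hneg : P.map (fun θ => -θ j) = gaussianReal (-m j) (v j) := by
    rw [← gaussianReal_map_neg, ← hmap j, Measure.map_map (by fun_prop) (by fun_prop)]
    rfl
  have h := gaussianReal_add_gaussianReal_of_indepFun
    ((hind.indepFun hij).comp measurable_id measurable_neg) (hmap i) hneg
  simp only [sub_eq_add_neg]
  exact h

/-- The event that a coordinate beats another one has the mass of a Gaussian half-line. -/
lemma pi_gaussianReal_real_le {ι : Type*} [Fintype ι] (m : ι → ℝ) (v : ι → NNReal) {i j : ι}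
    (hij : i ≠ j) :
    (Measure.pi fun l => gaussianReal (m l) (v l)).real {θ | θ j ≤ θ i}
      = (gaussianReal (m i - m j) (v i + v j)).real (Set.Ici 0) := by
  rw [← pi_gaussianReal_map_sub m v hij, map_measureReal_apply (by fun_prop) measurableSet_Ici]
  congr 1
  ext θ
  simp

/-- The complement of `alphaBest` is the mass of the event that some other arm is at least as good
as arm `0`. -/
lemma one_sub_alphaBest (k : ℕ) [NeZero k] (σ : ℝ) (m : Fin k → ℝ) (T : Fin k → ℕ) :
    1 - alphaBest k σ m T =
      (Measure.pi fun i => gaussianReal (m i) (Real.toNNReal (σ ^ 2 / (T i : ℝ)))).real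
        (⋃ i : {j : Fin k // j ≠ 0}, {θ | θ 0 ≤ θ i.1}) := by
  have hmeas : MeasurableSet {θ : Fin k → ℝ | ∀ i, i ≠ 0 → θ i < θ 0} := by
    simp only [Set.ofPred_forall]
    exact .iInter fun i => .iInter fun _ =>
      measurableSet_lt (measurable_pi_apply i) (measurable_pi_apply 0)
  rw [alphaBest, ← measureReal_def, ← probReal_compl_eq_one_sub hmeas]
  congr 1
  ext θ
  simp

/-- Union and Chernoff bound for the posterior probability of incorrect selection. -/
lemma one_sub_alphaBest_le {k : ℕ} [NeZero k] {σ : ℝ} (hσ : 0 < σ) {m : Fin k → ℝ}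
    {T : Fin k → ℕ} (hT : ∀ i, 1 ≤ T i) (hm : ∀ i, i ≠ 0 → m i ≤ m 0) :
    1 - alphaBest k σ m T ≤ ∑ i : {j : Fin k // j ≠ 0},
      Real.exp (-((m i.1 - m 0) ^ 2 / (2 * (σ ^ 2 / T i.1 + σ ^ 2 / T 0)))) := by
  rw [one_sub_alphaBest]
  refine (measureReal_iUnion_fintype_le _).trans (Finset.sum_le_sum fun i _ => ?_)
  have hT' (j : Fin k) : (0 : ℝ) < T j := by exact_mod_cast hT j
  have hpos (j : Fin k) : 0 < σ ^ 2 / (T j : ℝ) := div_pos (by positivity) (hT' j)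
  rw [pi_gaussianReal_real_le _ _ i.2]
  refine (gaussianReal_real_Ici_zero_le (sub_nonpos.2 (hm _ i.2)) ?_).trans_eq ?_
  · have := Real.toNNReal_pos.2 (hpos i.1)
    positivity
  · simp [(hpos _).le]

/-- Each suboptimal arm gives a lower bound for the posterior probability of incorrect selection. -/
lemma le_one_sub_alphaBest {k : ℕ} [NeZero k] {σ : ℝ} (hσ : 0 < σ) {m : Fin k → ℝ}
    {T : Fin k → ℕ} (hT : ∀ i, 1 ≤ T i) {i : Fin k} (hi : i ≠ 0) (hm : m i ≤ m 0) :
    (√(2 * Real.pi))⁻¹ * Real.exp (-((√(σ ^ 2 / T i + σ ^ 2 / T 0) - (m i - m 0)) ^ 2 /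
      (2 * (σ ^ 2 / T i + σ ^ 2 / T 0)))) ≤ 1 - alphaBest k σ m T := by
  rw [one_sub_alphaBest]
  have hT' (j : Fin k) : (0 : ℝ) < T j := by exact_mod_cast hT j
  have hpos (j : Fin k) : 0 < σ ^ 2 / (T j : ℝ) := div_pos (by positivity) (hT' j)
  refine le_trans ?_ (measureReal_mono (Set.subset_iUnion _ (⟨i, hi⟩ : {j : Fin k // j ≠ 0})))
  rw [pi_gaussianReal_real_le _ _ hi]
  refine le_trans (le_of_eq ?_) (le_gaussianReal_real_Ici_zero (sub_nonpos.2 hm) ?_)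
  · simp [(hpos _).le]
  · have := Real.toNNReal_pos.2 (hpos i)
    positivity

/-- If the empirical means converge to the true means and the sampling proportions converge to a
probability vector `w`, the posterior probability of incorrect selection decays at exponential
rate `min_{i ≠ 1} (μ i − μ 1)² / (2σ²(1/w i + 1/w 1))`. -/
theorem posterior_convergence_rate {k : ℕ} [NeZero k] (hk : 2 ≤ k) (σ : ℝ) (hσ : 0 < σ)
    (μ : Fin k → ℝ) (hμ : ∀ i, i ≠ 0 → μ i < μ 0)
    (w : Fin k → ℝ) (hw : ∀ i, w i ∈ Set.Ioo (0 : ℝ) 1) (hw1 : ∑ i, w i = 1)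
    (T : ℕ → Fin k → ℕ) (hT : ∀ n, 1 ≤ n → ∀ i, 1 ≤ T n i)
    (μn : ℕ → Fin k → ℝ)
    (hTlim : ∀ i, Tendsto (fun n : ℕ => (T n i : ℝ) / n) atTop (nhds (w i)))
    (hμlim : ∀ i, Tendsto (fun n : ℕ => μn n i) atTop (nhds (μ i))) :
    Tendsto (fun n : ℕ => -(1 / (n : ℝ)) * Real.log (1 - alphaBest k σ (μn n) (T n)))
      atTop
      (nhds (⨅ i : {j : Fin k // j ≠ 0},
        (μ i.1 - μ 0) ^ 2 / (2 * σ ^ 2 * (1 / w i.1 + 1 / w 0)))) := by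
  have hne : Nonempty {j : Fin k // j ≠ 0} :=
    ⟨⟨⟨1, hk⟩, fun h => by simpa using congrArg Fin.val h⟩⟩
  set V : ℕ → Fin k → ℝ := fun n i => σ ^ 2 / T n i + σ ^ 2 / T n 0 with hV
  set c : Fin k → ℝ := fun i => (μ i - μ 0) ^ 2 / (2 * σ ^ 2 * (1 / w i + 1 / w 0)) with hc
  have hw0 (i : Fin k) : 0 < w i := (hw i).1
  have hVlim (i : Fin k) :
      Tendsto (fun n : ℕ => 2 * V n i * n) atTop (nhds (2 * σ ^ 2 * (1 / w i + 1 / w 0))) := by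
    have h := (((hTlim i).inv₀ (hw0 i).ne').add ((hTlim 0).inv₀ (hw0 0).ne')).const_mul (2 * σ ^ 2)
    simp only [← one_div] at h
    refine h.congr fun n => ?_
    simp only [hV, one_div_div]
    ring
  have hlim_ne (i : Fin k) : 2 * σ ^ 2 * (1 / w i + 1 / w 0) ≠ 0 := by
    have := hw0 i
    have := hw0 0
    positivity
  have hd (i : Fin k) : Tendsto (fun n => μn n i - μn n 0) atTop (nhds (μ i - μ 0)) :=
    (hμlim i).sub (hμlim 0)
  have hV0 (i : Fin k) : Tendsto (fun n : ℕ => √(V n i)) atTop (nhds 0) := by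
    have h := ((hVlim i).mul (tendsto_inv_atTop_nhds_zero_nat (𝕜 := ℝ))).const_mul (1 / 2)
    simp only [mul_zero] at h
    rw [← Real.sqrt_zero]
    refine (h.congr' ?_).sqrt
    filter_upwards [eventually_ge_atTop 1] with n hn
    have : (0 : ℝ) < n := by exact_mod_cast hn
    field_simp
  have hrate (i : Fin k) :
      Tendsto (fun n : ℕ => (μn n i - μn n 0) ^ 2 / (2 * V n i * n)) atTop (nhds (c i)) :=
    ((hd i).pow 2).div (hVlim i) (hlim_ne i)
  have hrate' (i : Fin k) :
      Tendsto (fun n : ℕ => (√(V n i) - (μn n i - μn n 0)) ^ 2 / (2 * V n i * n))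
        atTop (nhds (c i)) := by
    have h := (((hV0 i).sub (hd i)).pow 2).div (hVlim i) (hlim_ne i)
    rwa [zero_sub, neg_sq] at h
  have hmean : ∀ᶠ n in atTop, ∀ i, i ≠ 0 → μn n i ≤ μn n 0 := by
    rw [eventually_all]
    intro i
    by_cases hi : i = 0
    · simp [hi]
    · filter_upwards [(hμlim i).eventually_lt (hμlim 0) (hμ i hi)] with n hn _ using hn.le
  have hconst (a : ℝ) : Tendsto (fun n : ℕ => a / (n : ℝ)) atTop (nhds 0) :=
    tendsto_const_div_atTop_nhds_zero_nat a
  obtain ⟨i₀, hi₀⟩ := exists_eq_ciInf_of_finite (f := fun i : {j : Fin k // j ≠ 0} => c i.1)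
  set r : ℕ → ℝ := fun n => ⨅ i : {j : Fin k // j ≠ 0},
    (μn n i.1 - μn n 0) ^ 2 / (2 * V n i.1 * n) with hr
  have hrlim : Tendsto r atTop (nhds (⨅ i : {j : Fin k // j ≠ 0}, c i.1)) := by
    simp only [hr, ← Finset.inf'_univ_eq_ciInf]
    exact Tendsto.finset_inf'_nhds_apply _ fun i _ => hrate i.1
  set N : ℝ := (Fintype.card {j : Fin k // j ≠ 0} : ℝ) with hN
  have hNpos : 0 < N := by
    rw [hN]
    exact_mod_cast Fintype.card_pos
  have hupper := (hconst (Real.log √(2 * Real.pi))).add (hrate' i₀.1)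
  have hlower := hrlim.sub (hconst (Real.log N))
  rw [zero_add, hi₀] at hupper
  rw [sub_zero] at hlower
  refine tendsto_of_tendsto_of_tendsto_of_le_of_le' hlower hupper ?_ ?_
  · filter_upwards [eventually_ge_atTop 1, hmean] with n hn hm
    have hn' : (0 : ℝ) < n := by exact_mod_cast hn
    have hlow := le_one_sub_alphaBest hσ (hT n hn) i₀.2 (hm _ i₀.2)
    have hpos : 0 < 1 - alphaBest k σ (μn n) (T n) := lt_of_lt_of_le (by positivity) hlow
    have hup : 1 - alphaBest k σ (μn n) (T n) ≤ N * Real.exp (-(n * r n)) := by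
      refine (one_sub_alphaBest_le hσ (hT n hn) hm).trans ?_
      rw [hN, ← nsmul_eq_mul]
      refine Finset.sum_le_card_nsmul _ _ _ fun i _ => Real.exp_le_exp.2 (neg_le_neg ?_)
      have h : r n ≤ (μn n i.1 - μn n 0) ^ 2 / (2 * V n i.1 * n) :=
        ciInf_le (Set.finite_range _).bddBelow i
      rw [← div_div, le_div_iff₀ hn'] at h
      linarith
    have hlog := Real.log_le_log hpos hup
    rw [Real.log_mul hNpos.ne' (Real.exp_ne_zero _), Real.log_exp] at hlog
    have := mul_le_mul_of_nonneg_left hlog (one_div_pos.2 hn').le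
    have heq : 1 / (n : ℝ) * (Real.log N + -(n * r n)) = Real.log N / n - r n := by
      field_simp
      ring
    linarith
  · filter_upwards [eventually_ge_atTop 1, hmean] with n hn hm
    have hn' : (0 : ℝ) < n := by exact_mod_cast hn
    have hlow := le_one_sub_alphaBest hσ (hT n hn) i₀.2 (hm _ i₀.2)
    have hlog := Real.log_le_log (by positivity) hlow
    rw [Real.log_mul (by positivity) (Real.exp_ne_zero _), Real.log_exp, Real.log_inv] at hlog
    have := mul_le_mul_of_nonneg_left hlog (one_div_pos.2 hn').le
    rw [← div_div]
    have heq (a b : ℝ) : 1 / (n : ℝ) * (-a + -b) = -(a / n + b / n) := by ring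
    rw [heq] at this
    linarith
end

section
/- Let k ≥ 2 and σ > 0. For each n ≥ 1 and each i ∈ {1,…,k} let T_{n,i} ≥ 1 be a positive integer and μ_{n,i} a real number. Suppose there is a nonempty subset B ⊆ {1,…,k} such that for every i ∈ B the sequences (T_{n,i})_n and (μ_{n,i})_n are eventually constant, while for every i ∉ B one has T_{n,i} → ∞ and μ_{n,i} converges to a finite limit. Then lim_{n→∞} (1/n) log(1 − α_{n,1}) = 0; that is, if some arm is sampled only finitely often, the posterior probability of incorrect selection does not decay at any exponential rate. -/
open MeasureTheory ProbabilityTheory Filter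

open scoped NNReal in
/-- A real Gaussian law and its mirror image give reflected half-lines the same mass. -/
theorem gaussianReal_real_Ici_eq (m : ℝ) (v : ℝ≥0) (a : ℝ) :
    (gaussianReal m v).real (Set.Ici a) = (gaussianReal (-m) v).real (Set.Iic (-a)) := by
  rw [← gaussianReal_map_neg, map_measureReal_apply measurable_neg measurableSet_Iic]
  congr 1
  ext x
  simp

open scoped NNReal in
/-- A real Gaussian law gives mass at least one half to a half-line containing its mean. -/
theorem half_le_gaussianReal_real_Iic {m a : ℝ} (v : ℝ≥0) (h : m ≤ a) :
    1 / 2 ≤ (gaussianReal m v).real (Set.Iic a) := by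
  have hsymm : (gaussianReal m v).real (Set.Ici m) = (gaussianReal m v).real (Set.Iic m) := by
    have hmap : (gaussianReal m v).map (fun x => 2 * m - x) = gaussianReal m v := by
      rw [gaussianReal_map_const_sub]
      congr 1
      ring
    conv_lhs => rw [← hmap]
    rw [map_measureReal_apply (by fun_prop) measurableSet_Ici]
    congr 1
    ext x
    simp only [Set.mem_preimage, Set.mem_Ici, Set.mem_Iic]
    constructor <;> intro hx <;> linarith
  have hcover : 1 ≤ (gaussianReal m v).real (Set.Iic m) + (gaussianReal m v).real (Set.Ici m) := by
    have := measureReal_union_le (μ := gaussianReal m v) (Set.Iic m) (Set.Ici m)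
    rwa [Set.Iic_union_Ici, probReal_univ] at this
  have hmono : (gaussianReal m v).real (Set.Iic m) ≤ (gaussianReal m v).real (Set.Iic a) :=
    measureReal_mono (Set.Iic_subset_Iic.2 h)
  linarith

open scoped NNReal in
/-- A nondegenerate real Gaussian law charges every left half-line. -/
theorem gaussianReal_real_Iic_pos (m : ℝ) {v : ℝ≥0} (hv : v ≠ 0) (a : ℝ) :
    0 < (gaussianReal m v).real (Set.Iic a) := by
  rw [measureReal_def, ENNReal.toReal_pos_iff]
  refine ⟨pos_iff_ne_zero.2 fun h => ?_, measure_lt_top _ _⟩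
  have := gaussianReal_absolutelyContinuous' m hv h
  simp at this

open scoped NNReal in
/-- Along a sequence of Gaussian laws which is eventually constant and nondegenerate, or whose
means eventually lie in `Iic a`, the mass of `Iic a` is bounded away from zero. -/
theorem exists_pos_le_gaussianReal_real_Iic {m : ℕ → ℝ} {v : ℕ → ℝ≥0} {a : ℝ}
    (h : (∃ m₀ v₀, v₀ ≠ 0 ∧ ∀ᶠ n in atTop, m n = m₀ ∧ v n = v₀) ∨ ∀ᶠ n in atTop, m n ≤ a) :
    ∃ c > 0, ∀ᶠ n in atTop, c ≤ (gaussianReal (m n) (v n)).real (Set.Iic a) := by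
  rcases h with ⟨m₀, v₀, hv₀, h⟩ | h
  · refine ⟨_, gaussianReal_real_Iic_pos m₀ hv₀ a, h.mono fun n hn => ?_⟩
    rw [hn.1, hn.2]
  · exact ⟨1 / 2, by norm_num, h.mono fun n hn => half_le_gaussianReal_real_Iic _ hn⟩

/-- The probability of incorrect selection is at least that of `θ 0 ≤ a ≤ θ j`. -/
theorem mul_le_one_sub_alphaBest {k : ℕ} [NeZero k] (σ : ℝ) (m : Fin k → ℝ) (T : Fin k → ℕ)
    {j : Fin k} (hj : j ≠ 0) (a : ℝ) :
    (gaussianReal (m 0) (Real.toNNReal (σ ^ 2 / (T 0 : ℝ)))).real (Set.Iic a) *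
      (gaussianReal (m j) (Real.toNNReal (σ ^ 2 / (T j : ℝ)))).real (Set.Ici a) ≤
        1 - alphaBest k σ m T := by
  set P := Measure.pi fun i => gaussianReal (m i) (Real.toNNReal (σ ^ 2 / (T i : ℝ))) with hP
  let s : Fin k → Set ℝ := fun i =>
    if i = 0 then Set.Iic a else if i = j then Set.Ici a else Set.univ
  have hs0 : s 0 = Set.Iic a := if_pos rfl
  have hsj : s j = Set.Ici a := (if_neg hj).trans (if_pos rfl)
  have hs : MeasurableSet (Set.univ.pi s) := by
    refine MeasurableSet.univ_pi fun i => ?_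
    dsimp only [s]
    split_ifs <;> measurability
  have hbox : P.real (Set.univ.pi s) =
      (gaussianReal (m 0) (Real.toNNReal (σ ^ 2 / (T 0 : ℝ)))).real (Set.Iic a) *
        (gaussianReal (m j) (Real.toNNReal (σ ^ 2 / (T j : ℝ)))).real (Set.Ici a) := by
    rw [measureReal_def, hP, Measure.pi_pi, Finset.prod_eq_mul 0 j hj.symm, hs0, hsj,
      ENNReal.toReal_mul]
    · rfl
    · rintro i - ⟨hi0, hij⟩
      simp [s, hi0, hij]
    · simp
    · simp
  have hα : alphaBest k σ m T ≤ P.real (Set.univ.pi s)ᶜ := by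
    refine measureReal_mono fun θ hθ hmem => ?_
    have h0 := hmem 0 (Set.mem_univ _)
    have h1 := hmem j (Set.mem_univ _)
    rw [hs0, Set.mem_Iic] at h0
    rw [hsj, Set.mem_Ici] at h1
    exact absurd (hθ j hj) (not_lt.2 (h0.trans h1))
  rw [probReal_compl_eq_one_sub hs, hbox] at hα
  linarith

/-- A sequence in `(0, 1]` that is bounded away from zero does not decay exponentially. -/
theorem tendsto_one_div_mul_log_zero {u : ℕ → ℝ} {c : ℝ} (hc : 0 < c)
    (hcu : ∀ᶠ n in atTop, c ≤ u n) (hu : ∀ n, u n ≤ 1) :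
    Tendsto (fun n : ℕ => (1 / (n : ℝ)) * Real.log (u n)) atTop (nhds 0) := by
  have hlim : Tendsto (fun n : ℕ => (1 / (n : ℝ)) * Real.log c) atTop (nhds 0) := by
    simpa using tendsto_one_div_atTop_nhds_zero_nat.mul_const (Real.log c)
  refine tendsto_of_tendsto_of_tendsto_of_le_of_le' hlim tendsto_const_nhds ?_ ?_
  · filter_upwards [hcu] with n hn
    gcongr
  · filter_upwards [hcu] with n hn
    exact mul_nonpos_of_nonneg_of_nonpos (by positivity)
      (Real.log_nonpos (hc.le.trans hn) (hu n))

/-- If some nonempty set `B` of arms is sampled only finitely often (their sample counts and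
posterior means are eventually constant), while every other arm is sampled infinitely often with
converging posterior mean, then the posterior probability of incorrect selection does not decay
at any exponential rate. -/
theorem no_exponential_decay_with_finitely_sampled_arm {k : ℕ} [NeZero k] (hk : 2 ≤ k)
    (σ : ℝ) (hσ : 0 < σ)
    (T : ℕ → Fin k → ℕ) (hT : ∀ n, 1 ≤ n → ∀ i, 1 ≤ T n i)
    (μn : ℕ → Fin k → ℝ)
    (B : Set (Fin k)) (hB : B.Nonempty)
    (hBconst : ∀ i ∈ B, ∃ N : ℕ, ∀ n, N ≤ n → T n i = T N i ∧ μn n i = μn N i)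
    (hnotB : ∀ i ∉ B, Tendsto (fun n : ℕ => T n i) atTop atTop ∧
      ∃ L : ℝ, Tendsto (fun n : ℕ => μn n i) atTop (nhds L)) :
    Tendsto (fun n : ℕ => (1 / (n : ℝ)) * Real.log (1 - alphaBest k σ (μn n) (T n)))
      atTop (nhds 0) := by
  let v : ℕ → Fin k → NNReal := fun n i => Real.toNNReal (σ ^ 2 / (T n i : ℝ))
  have hconst : ∀ i ∈ B, ∃ m₀ v₀, v₀ ≠ 0 ∧ ∀ᶠ n in atTop, μn n i = m₀ ∧ v n i = v₀ := by
    intro i hi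
    obtain ⟨N, hN⟩ := hBconst i hi
    have hpos : 0 < T N i := by
      rw [← (hN (N + 1) N.le_succ).1]
      exact hT (N + 1) (Nat.le_add_left 1 N) i
    refine ⟨μn N i, v N i, ?_, ?_⟩
    · exact (Real.toNNReal_pos.2 (by positivity)).ne'
    · filter_upwards [eventually_ge_atTop N] with n hn
      exact ⟨(hN n hn).2, by simp only [v, (hN n hn).1]⟩
  have hlower : ∀ (i : Fin k) (a : ℝ), (i ∉ B → ∀ᶠ n in atTop, μn n i ≤ a) →
      ∃ c > 0, ∀ᶠ n in atTop, c ≤ (gaussianReal (μn n i) (v n i)).real (Set.Iic a) := by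
    intro i a h
    by_cases hi : i ∈ B
    · exact exists_pos_le_gaussianReal_real_Iic (.inl (hconst i hi))
    · exact exists_pos_le_gaussianReal_real_Iic (.inr (h hi))
  have hupper : ∀ (i : Fin k) (a : ℝ), (i ∉ B → ∀ᶠ n in atTop, a ≤ μn n i) →
      ∃ c > 0, ∀ᶠ n in atTop, c ≤ (gaussianReal (μn n i) (v n i)).real (Set.Ici a) := by
    intro i a h
    simp only [gaussianReal_real_Ici_eq]
    by_cases hi : i ∈ B
    · obtain ⟨m₀, v₀, hv₀, h₀⟩ := hconst i hi
      exact exists_pos_le_gaussianReal_real_Iic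
        (.inl ⟨-m₀, v₀, hv₀, h₀.mono fun n hn => ⟨by rw [hn.1], hn.2⟩⟩)
    · exact exists_pos_le_gaussianReal_real_Iic
        (.inr ((h hi).mono fun n hn => neg_le_neg hn))
  obtain ⟨j, hj, a, ha0, haj⟩ : ∃ j : Fin k, j ≠ 0 ∧ ∃ a : ℝ,
      (0 ∉ B → ∀ᶠ n in atTop, μn n 0 ≤ a) ∧ (j ∉ B → ∀ᶠ n in atTop, a ≤ μn n j) := by
    by_cases h0 : (0 : Fin k) ∈ B
    · have : Nontrivial (Fin k) := Fin.nontrivial_iff_two_le.2 hk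
      obtain ⟨j, hj⟩ := exists_ne (0 : Fin k)
      by_cases hjB : j ∈ B
      · exact ⟨j, hj, 0, fun h => absurd h0 h, fun h => absurd hjB h⟩
      · obtain ⟨-, L, hL⟩ := hnotB j hjB
        exact ⟨j, hj, L - 1, fun h => absurd h0 h, fun _ => hL.eventually_const_le (by linarith)⟩
    · obtain ⟨j, hjB⟩ := hB
      obtain ⟨-, L, hL⟩ := hnotB 0 h0
      exact ⟨j, fun h => h0 (h ▸ hjB), L + 1, fun _ => hL.eventually_le_const (by linarith),
        fun h => absurd hjB h⟩
  obtain ⟨c, hc, hc'⟩ := hlower 0 a ha0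
  obtain ⟨d, hd, hd'⟩ := hupper j a haj
  refine tendsto_one_div_mul_log_zero (mul_pos hc hd) ?_ fun n => ?_
  · filter_upwards [hc', hd'] with n hcn hdn
    exact (mul_le_mul hcn hdn hd.le measureReal_nonneg).trans
      (mul_le_one_sub_alphaBest σ (μn n) (T n) hj a)
  · exact sub_le_self _ ENNReal.toReal_nonneg
end

section
/- Let Γ > 0, α > 0, C ≥ 1, δ ∈ (0,1), and ε ∈ (0, Γ/(1+α)). Let M be a positive integer with M ≥ 1/ε², and let Z : ℕ → ℝ be a sequence satisfying Z_n ≥ (Γ − ε)n for all n ≥ M. Then there exists an integer n with 1 ≤ n ≤ M + (log C + log(1/δ))/(Γ − (1+α)ε) + 2 such that Z_n > log(C n^α / δ); consequently the stopping time τ_δ = inf{ n ≥ 1 : Z_n > log(C n^α/δ) } satisfies τ_δ ≤ M + (log C + log(1/δ))/(Γ − (1+α)ε) + 2. -/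
open Filter

theorem Real.log_le_sqrt {x : ℝ} (hx : 0 < x) : Real.log x ≤ √x := by
  have hs : 0 < √(√x) := Real.sqrt_pos.2 (Real.sqrt_pos.2 hx)
  have hlog : Real.log x = 4 * Real.log √(√x) := by
    rw [Real.log_sqrt (Real.sqrt_nonneg x), Real.log_sqrt hx.le]
    ring
  have hsq : √(√x) ^ 2 = √x := Real.sq_sqrt (Real.sqrt_nonneg x)
  nlinarith [Real.log_le_sub_one_of_pos hs, sq_nonneg (√(√x) - 2)]

theorem Real.log_le_mul_of_one_div_sq_le {ε x : ℝ} (hε : 0 < ε) (hx : 1 / ε ^ 2 ≤ x) :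
    Real.log x ≤ ε * x := by
  have hx0 : 0 < x := lt_of_lt_of_le (by positivity) hx
  refine (Real.log_le_sqrt hx0).trans (Real.sqrt_le_iff.2 ⟨by positivity, ?_⟩)
  rw [div_le_iff₀ (by positivity)] at hx
  nlinarith

/-- Deterministic core of the fixed-confidence sample-size bound: if `Z n ≥ (Γ − ε) n` for all
`n ≥ M` (with `M ≥ 1/ε²`), then the threshold `log(C n^α / δ)` is crossed at some time
`n ≤ M + (log C + log(1/δ))/(Γ − (1+α)ε) + 2`, and hence the stopping time
`τ_δ = inf { n ≥ 1 : Z n > log(C n^α / δ) }` is bounded by the same quantity. -/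
theorem chernoff_threshold_crossing (Γ a C δ ε : ℝ) (hΓ : 0 < Γ) (ha : 0 < a) (hC : 1 ≤ C)
    (hδ : δ ∈ Set.Ioo (0 : ℝ) 1) (hε : ε ∈ Set.Ioo (0 : ℝ) (Γ / (1 + a)))
    (M : ℕ) (hM : 1 ≤ M) (hMε : (1 : ℝ) / ε ^ 2 ≤ M)
    (Z : ℕ → ℝ) (hZ : ∀ n : ℕ, M ≤ n → (Γ - ε) * n ≤ Z n) :
    (∃ n : ℕ, 1 ≤ n ∧
        (n : ℝ) ≤ M + (Real.log C + Real.log (1 / δ)) / (Γ - (1 + a) * ε) + 2 ∧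
        Real.log (C * (n : ℝ) ^ a / δ) < Z n) ∧
      ((sInf {n : ℕ | 1 ≤ n ∧ Real.log (C * (n : ℝ) ^ a / δ) < Z n} : ℕ) : ℝ)
        ≤ M + (Real.log C + Real.log (1 / δ)) / (Γ - (1 + a) * ε) + 2 := by
  obtain ⟨hδ0, hδ1⟩ := hδ
  obtain ⟨hε0, hε1⟩ := hε
  have hD : 0 < Γ - (1 + a) * ε := by
    rw [lt_div_iff₀ (by linarith)] at hε1
    linarith
  set D := Γ - (1 + a) * ε with hDdef
  set B := Real.log C + Real.log (1 / δ) with hBdef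
  have hB : 0 ≤ B := add_nonneg (Real.log_nonneg hC)
    (Real.log_nonneg ((one_le_div hδ0).2 hδ1.le))
  suffices h : ∃ n : ℕ, 1 ≤ n ∧ (n : ℝ) ≤ M + B / D + 2 ∧
      Real.log (C * (n : ℝ) ^ a / δ) < Z n by
    refine ⟨h, ?_⟩
    obtain ⟨n, hn1, hn, hnZ⟩ := h
    refine le_trans ?_ hn
    rw [Nat.cast_le]
    exact Nat.sInf_le ⟨hn1, hnZ⟩
  have hfloor_le : (⌊B / D⌋₊ : ℝ) ≤ B / D := Nat.floor_le (by positivity)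
  have hlt_floor : B / D < ⌊B / D⌋₊ + 1 := Nat.lt_floor_add_one _
  have hn_cast : ((M + ⌊B / D⌋₊ + 1 : ℕ) : ℝ) = M + ⌊B / D⌋₊ + 1 := by push_cast; ring
  have hMn : M ≤ M + ⌊B / D⌋₊ + 1 := by omega
  refine ⟨M + ⌊B / D⌋₊ + 1, by omega, by linarith, lt_of_lt_of_le ?_ (hZ _ hMn)⟩
  have hMn' : (M : ℝ) ≤ (M + ⌊B / D⌋₊ + 1 : ℕ) := Nat.cast_le.2 hMn
  have hM0 : (0 : ℝ) < M := by exact_mod_cast hM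
  have hBn : B / D < (M + ⌊B / D⌋₊ + 1 : ℕ) := by linarith
  generalize ((M + ⌊B / D⌋₊ + 1 : ℕ) : ℝ) = x at hMn' hBn ⊢
  have hx : 0 < x := hM0.trans_le hMn'
  have hlogx : Real.log x ≤ ε * x := Real.log_le_mul_of_one_div_sq_le hε0 (hMε.trans hMn')
  have hlog : Real.log (C * x ^ a / δ) = B + a * Real.log x := by
    rw [Real.log_div (by positivity) hδ0.ne', Real.log_mul (by positivity) (by positivity),
      Real.log_rpow hx, hBdef, one_div, Real.log_inv]
    ring
  rw [div_lt_iff₀ hD] at hBn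
  rw [hlog]
  calc B + a * Real.log x < x * D + a * (ε * x) :=
        add_lt_add_of_lt_of_le hBn (mul_le_mul_of_nonneg_left hlogx ha.le)
    _ = (Γ - ε) * x := by rw [hDdef]; ring
end

section
/- Let k ≥ 2, β ∈ (0,1), and let μ_1, …, μ_k be real numbers with μ_1 > μ_i for every i ∈ {2,…,k}. Then there exists a unique vector (w_2, …, w_k) of strictly positive reals such that w_2 + … + w_k = 1 − β and (μ_2 − μ_1)²/(1/w_2 + 1/β) = (μ_3 − μ_1)²/(1/w_3 + 1/β) = … = (μ_k − μ_1)²/(1/w_k + 1/β). -/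
open Finset in
/-- For positive gaps `d i`, some positive vector of total mass `s` equalizes
`d i / (1 / w i + 1 / β)`. -/
lemma exists_equalizing_weights {ι : Type*} [Fintype ι] [Nonempty ι] {d : ι → ℝ}
    (hd : ∀ i, 0 < d i) {β s : ℝ} (hβ : 0 < β) (hs : 0 < s) :
    ∃ w : ι → ℝ, (∀ i, 0 < w i) ∧ ∑ i, w i = s ∧
      ∀ i j, d i / (1 / w i + 1 / β) = d j / (1 / w j + 1 / β) := by
  obtain ⟨m, hm⟩ := Finite.exists_min d
  let W : ℝ → ι → ℝ := fun x i => x * β * d m / (d i * β + (d i - d m) * x)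
  have hden : ∀ x, 0 ≤ x → ∀ i, 0 < d i * β + (d i - d m) * x := fun x hx i =>
    add_pos_of_pos_of_nonneg (mul_pos (hd i) hβ) (mul_nonneg (sub_nonneg.2 (hm i)) hx)
  have hWm : W s m = s := by
    have := hd m
    simp only [W, sub_self, zero_mul, add_zero]
    field_simp
  have hW0 : ∑ i, W 0 i = 0 := by simp [W]
  have hWs : s ≤ ∑ i, W s i := by
    conv_lhs => rw [← hWm]
    refine single_le_sum (f := W s) (fun i _ => ?_) (mem_univ m)
    exact div_nonneg (mul_pos (mul_pos hs hβ) (hd m)).le (hden s hs.le i).le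
  have hcont : ContinuousOn (fun x => ∑ i, W x i) (Set.Icc 0 s) := by
    refine continuousOn_finsetSum _ fun i _ => ContinuousOn.div ?_ ?_ ?_
    · fun_prop
    · fun_prop
    · exact fun x hx => (hden x hx.1 i).ne'
  obtain ⟨x, hx, hxs⟩ := intermediate_value_Icc hs.le hcont ⟨hW0.trans_le hs.le, hWs⟩
  have hx0 : 0 < x := by
    refine hx.1.lt_of_ne ?_
    rintro rfl
    exact hs.ne (hW0.symm.trans hxs)
  have heq : ∀ i, d i / (1 / W x i + 1 / β) = x * β * d m / (β + x) := fun i => by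
    have hi := hd i
    have hm0 := hd m
    have hD := hden x hx.1 i
    have hinv : 1 / W x i + 1 / β = d i * (β + x) / (x * β * d m) := by
      simp only [W, one_div_div]
      field_simp
      ring
    rw [hinv]
    field_simp
  exact ⟨W x, fun i => div_pos (mul_pos (mul_pos hx0 hβ) (hd m)) (hden x hx.1 i), hxs,
    fun i j => (heq i).trans (heq j).symm⟩

/-- For a positive gap `d`, the map `w ↦ d / (1 / w + 1 / β)` reflects the order of positive
weights. -/
lemma le_of_div_one_div_add_le {d β v w : ℝ} (hd : 0 < d) (hβ : 0 < β) (hv : 0 < v) (hw : 0 < w)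
    (h : d / (1 / v + 1 / β) ≤ d / (1 / w + 1 / β)) : v ≤ w := by
  rw [div_le_div_iff_of_pos_left hd (by positivity) (by positivity)] at h
  exact (one_div_le_one_div hw hv).1 (le_of_add_le_add_right h)

/-- Positive vectors of equal total mass that both equalize `d i / (1 / w i + 1 / β)` coincide. -/
lemma equalizing_weights_unique {ι : Type*} [Fintype ι] [Nonempty ι] {d : ι → ℝ}
    (hd : ∀ i, 0 < d i) {β : ℝ} (hβ : 0 < β) {v w : ι → ℝ} (hv : ∀ i, 0 < v i)
    (hw : ∀ i, 0 < w i) (hsum : ∑ i, v i = ∑ i, w i)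
    (hve : ∀ i j, d i / (1 / v i + 1 / β) = d j / (1 / v j + 1 / β))
    (hwe : ∀ i j, d i / (1 / w i + 1 / β) = d j / (1 / w j + 1 / β)) : v = w := by
  obtain ⟨m⟩ := ‹Nonempty ι›
  wlog h : d m / (1 / v m + 1 / β) ≤ d m / (1 / w m + 1 / β) generalizing v w
  · exact (this hw hv hsum.symm hwe hve (le_of_not_ge h)).symm
  have hle : ∀ i, v i ≤ w i := fun i =>
    le_of_div_one_div_add_le (hd i) hβ (hv i) (hw i) (by rwa [hve i m, hwe i m])
  exact funext fun i =>
    (Finset.sum_eq_sum_iff_of_le fun i _ => hle i).1 hsum i (Finset.mem_univ i)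


/-- Existence and uniqueness of the asymptotically optimal sampling proportions: given a
fraction `β ∈ (0,1)` allocated to the best arm (arm `0`), there is a unique vector of strictly
positive weights `(w i)_{i ≠ 0}` summing to `1 − β` that equalizes the quantities
`(μ i − μ 0)² / (1/w i + 1/β)` over all suboptimal arms `i`. -/
theorem optimal_proportions_exist_unique {k : ℕ} [NeZero k] (hk : 2 ≤ k)
    (β : ℝ) (hβ : β ∈ Set.Ioo (0 : ℝ) 1)
    (μ : Fin k → ℝ) (hμ : ∀ i : Fin k, i ≠ 0 → μ i < μ 0) :
    ∃! w : {j : Fin k // j ≠ 0} → ℝ,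
      (∀ i, 0 < w i) ∧ (∑ i, w i = 1 - β) ∧
      ∀ i j : {j : Fin k // j ≠ 0},
        (μ i.1 - μ 0) ^ 2 / (1 / w i + 1 / β) = (μ j.1 - μ 0) ^ 2 / (1 / w j + 1 / β) := by
  have : Nonempty {j : Fin k // j ≠ 0} := by
    have : Nontrivial (Fin k) := Fin.nontrivial_iff_two_le.2 hk
    exact (exists_ne (0 : Fin k)).elim fun j hj => ⟨⟨j, hj⟩⟩
  have hd : ∀ i : {j : Fin k // j ≠ 0}, 0 < (μ i.1 - μ 0) ^ 2 := fun i =>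
    sq_pos_of_neg (sub_neg.2 (hμ i.1 i.2))
  obtain ⟨w, hw, hsum, heq⟩ := exists_equalizing_weights hd hβ.1 (sub_pos.2 hβ.2)
  exact ⟨w, ⟨hw, hsum, heq⟩, fun v ⟨hv, hvsum, hveq⟩ =>
    equalizing_weights_unique hd hβ.1 hv hw (hvsum.trans hsum.symm) hveq heq⟩
end

section
/- Let c > 0. Let (m_n)_{n≥1} be a bounded sequence of reals with m_n ≤ 0 for all sufficiently large n, and let (s_n)_{n≥1} be a sequence of strictly positive reals with n·s_n² ≥ c for all n. Then lim_{n→∞} (1/n) [ log( N(m_n, s_n²)([0,∞)) ) + m_n²/(2 s_n²) ] = 0; that is, the probability that a N(m_n, s_n²) random variable is nonnegative is logarithmically equivalent (at exponential scale in n) to exp(−m_n²/(2 s_n²)). -/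
open MeasureTheory ProbabilityTheory Filter

/-- Chernoff bound for a Gaussian with nonpositive mean. -/
lemma gaussianReal_Ici_zero_le {μ s : ℝ} (hμ : μ ≤ 0) (hs : 0 < s) :
    (gaussianReal μ (Real.toNNReal (s ^ 2))).real (Set.Ici 0) ≤
      Real.exp (-(μ ^ 2 / (2 * s ^ 2))) := by
  have ht : 0 ≤ -μ / s ^ 2 := div_nonneg (by linarith) (by positivity)
  have h := measure_ge_le_exp_mul_mgf (μ := gaussianReal μ (Real.toNNReal (s ^ 2)))
    (X := id) 0 ht (integrable_exp_mul_gaussianReal _)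
  rw [mgf_id_gaussianReal] at h
  refine h.trans_eq ?_
  rw [Real.coe_toNNReal _ (sq_nonneg s), ← Real.exp_add]
  congr 1
  field_simp
  ring

/-- Lower bound on the tail of a Gaussian with nonpositive mean, obtained by minimising
its density over `[0, s]`. -/
lemma le_gaussianReal_Ici_zero {μ s : ℝ} (hμ : μ ≤ 0) (hs : 0 < s) :
    (√(2 * Real.pi))⁻¹ * Real.exp (-((s - μ) ^ 2 / (2 * s ^ 2))) ≤
      (gaussianReal μ (Real.toNNReal (s ^ 2))).real (Set.Ici 0) := by
  have hv : Real.toNNReal (s ^ 2) ≠ 0 := (Real.toNNReal_pos.2 (by positivity)).ne'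
  have hpi : 0 < √(2 * Real.pi) := by positivity
  set v := Real.toNNReal (s ^ 2)
  have hvs : (v : ℝ) = s ^ 2 := Real.coe_toNNReal _ (sq_nonneg s)
  have hdens : ∀ x ∈ Set.Icc 0 s, gaussianPDFReal μ v s ≤ gaussianPDFReal μ v x := by
    rintro x ⟨hx0, hxs⟩
    simp only [gaussianPDFReal, neg_div]
    gcongr
    linarith
  have hIcc : (gaussianReal μ v).real (Set.Icc 0 s) =
      ∫ x in Set.Icc 0 s, gaussianPDFReal μ v x := by
    rw [measureReal_def, gaussianReal_apply_eq_integral μ hv, ENNReal.toReal_ofReal]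
    exact integral_nonneg fun x ↦ gaussianPDFReal_nonneg μ v x
  calc (√(2 * Real.pi))⁻¹ * Real.exp (-((s - μ) ^ 2 / (2 * s ^ 2)))
      = ∫ _ in Set.Icc 0 s, gaussianPDFReal μ v s := by
        rw [setIntegral_const, Real.volume_real_Icc_of_le hs.le, gaussianPDFReal, hvs,
          Real.sqrt_mul (by positivity : 0 ≤ 2 * Real.pi) (s ^ 2), Real.sqrt_sq hs.le,
          smul_eq_mul, neg_div]
        field_simp
        ring
    _ ≤ ∫ x in Set.Icc 0 s, gaussianPDFReal μ v x :=
        setIntegral_mono_on (integrableOn_const (by simp))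
          (integrable_gaussianPDFReal μ v).integrableOn measurableSet_Icc hdens
    _ = (gaussianReal μ v).real (Set.Icc 0 s) := hIcc.symm
    _ ≤ (gaussianReal μ v).real (Set.Ici 0) := measureReal_mono Set.Icc_subset_Ici_self

lemma log_gaussianReal_Ici_zero_add_le {μ s : ℝ} (hμ : μ ≤ 0) (hs : 0 < s) :
    Real.log ((gaussianReal μ (Real.toNNReal (s ^ 2))).real (Set.Ici 0)) +
      μ ^ 2 / (2 * s ^ 2) ≤ 0 := by
  have hpos := lt_of_lt_of_le (by positivity) (le_gaussianReal_Ici_zero hμ hs)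
  have h := Real.log_le_log hpos (gaussianReal_Ici_zero_le hμ hs)
  rw [Real.log_exp] at h
  linarith

lemma le_log_gaussianReal_Ici_zero_add {μ s : ℝ} (hμ : μ ≤ 0) (hs : 0 < s) :
    -(Real.log √(2 * Real.pi) + 1 / 2) - |μ| / s ≤
      Real.log ((gaussianReal μ (Real.toNNReal (s ^ 2))).real (Set.Ici 0)) +
        μ ^ 2 / (2 * s ^ 2) := by
  have h := Real.log_le_log (by positivity) (le_gaussianReal_Ici_zero hμ hs)
  rw [Real.log_mul (by positivity) (by positivity), Real.log_inv, Real.log_exp] at h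
  have hsq : (s - μ) ^ 2 / (2 * s ^ 2) = μ ^ 2 / (2 * s ^ 2) + |μ| / s + 1 / 2 := by
    rw [abs_of_nonpos hμ]
    field_simp
    ring
  linarith

/-- If `(m n)` is bounded and eventually nonpositive, and `(s n)` are positive with
`n · s n ² ≥ c > 0`, then `N(m n, s n ²)([0,∞))` is logarithmically equivalent (at exponential
scale in `n`) to `exp(− m n ² / (2 s n ²))`. -/
theorem gaussian_nonneg_prob_log_equiv (c : ℝ) (hc : 0 < c)
    (m s : ℕ → ℝ) (hbdd : ∃ B : ℝ, ∀ n : ℕ, 1 ≤ n → |m n| ≤ B)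
    (hm : ∀ᶠ n : ℕ in atTop, m n ≤ 0)
    (hs : ∀ n : ℕ, 1 ≤ n → 0 < s n)
    (hns : ∀ n : ℕ, 1 ≤ n → c ≤ (n : ℝ) * (s n) ^ 2) :
    Tendsto (fun n : ℕ =>
        (1 / (n : ℝ)) *
          (Real.log ((gaussianReal (m n) (Real.toNNReal ((s n) ^ 2)) (Set.Ici 0)).toReal) +
            (m n) ^ 2 / (2 * (s n) ^ 2)))
      atTop (nhds 0) := by
  obtain ⟨B, hB⟩ := hbdd
  set K := Real.log √(2 * Real.pi) + 1 / 2
  have hlim : Tendsto (fun n : ℕ ↦ -K * (n : ℝ)⁻¹ - B / √c * √(n : ℝ)⁻¹) atTop (nhds 0) := by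
    have h1 : Tendsto (fun n : ℕ ↦ (n : ℝ)⁻¹) atTop (nhds 0) := tendsto_inv_atTop_nhds_zero_nat
    have h2 : Tendsto (fun n : ℕ ↦ √(n : ℝ)⁻¹) atTop (nhds 0) := by
      simpa using h1.sqrt
    simpa using (h1.const_mul (-K)).sub (h2.const_mul (B / √c))
  refine tendsto_of_tendsto_of_tendsto_of_le_of_le' hlim tendsto_const_nhds ?_ ?_
  · filter_upwards [hm, eventually_ge_atTop 1] with n hmn hn
    have hn0 : (0 : ℝ) < n := by exact_mod_cast hn
    have hsn := hs n hn
    have hratio : |m n| / s n ≤ B / √c * √n := by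
      have hsqrt : √c ≤ √n * s n := by
        rw [← Real.sqrt_sq hsn.le, ← Real.sqrt_mul hn0.le]
        exact Real.sqrt_le_sqrt (hns n hn)
      have hB0 : 0 ≤ B := (abs_nonneg _).trans (hB n hn)
      have hc0 : 0 < √c := Real.sqrt_pos.2 hc
      rw [div_mul_eq_mul_div, div_le_div_iff₀ hsn hc0, mul_assoc]
      exact mul_le_mul (hB n hn) hsqrt hc0.le hB0
    have hrw : -K * (n : ℝ)⁻¹ - B / √c * √(n : ℝ)⁻¹ =
        1 / (n : ℝ) * (-K - B / √c * √n) := by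
      have : √(n : ℝ)⁻¹ = (n : ℝ)⁻¹ * √n := by
        rw [Real.sqrt_inv, inv_mul_eq_div, Real.sqrt_div_self', one_div]
      rw [this]
      ring
    rw [hrw]
    refine mul_le_mul_of_nonneg_left ?_ (by positivity)
    exact (sub_le_sub_left hratio _).trans (le_log_gaussianReal_Ici_zero_add hmn hsn)
  · filter_upwards [hm, eventually_ge_atTop 1] with n hmn hn
    exact mul_nonpos_of_nonneg_of_nonpos (by positivity)
      (log_gaussianReal_Ici_zero_add_le hmn (hs n hn))
end

section
/- For every x ≥ 2, f(−x) > φ(x)/x³, where f(x) = xΦ(x) + φ(x); that is, for x ≥ 2 the expected-improvement function at −x exceeds the standard normal density at x divided by x³. -/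
open MeasureTheory ProbabilityTheory

/-- The probability density function `φ` of the standard normal distribution. -/
noncomputable def stdGaussPdf (x : ℝ) : ℝ := (Real.sqrt (2 * Real.pi))⁻¹ * Real.exp (-x ^ 2 / 2)

/-- The cumulative distribution function `Φ` of the standard normal distribution. -/
noncomputable def stdGaussCdf (x : ℝ) : ℝ := ((gaussianReal 0 1) (Set.Iic x)).toReal

/-- The expected-improvement function `f(x) = x Φ(x) + φ(x)`. -/
noncomputable def eiF (x : ℝ) : ℝ := x * stdGaussCdf x + stdGaussPdf x

open Filter Topology Set

theorem gaussianPDFReal_zero_one_eq_stdGaussPdf : gaussianPDFReal 0 1 = stdGaussPdf := by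
  ext x
  simp [gaussianPDFReal, stdGaussPdf]

theorem stdGaussPdf_pos (x : ℝ) : 0 < stdGaussPdf x := by
  unfold stdGaussPdf
  positivity

theorem stdGaussPdf_neg (x : ℝ) : stdGaussPdf (-x) = stdGaussPdf x := by
  simp [stdGaussPdf]

theorem continuous_stdGaussPdf : Continuous stdGaussPdf := by
  unfold stdGaussPdf
  fun_prop

theorem integrable_stdGaussPdf : Integrable stdGaussPdf :=
  gaussianPDFReal_zero_one_eq_stdGaussPdf ▸ integrable_gaussianPDFReal 0 1

theorem hasDerivAt_stdGaussPdf (x : ℝ) : HasDerivAt stdGaussPdf (-x * stdGaussPdf x) x := by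
  have h : HasDerivAt (fun y : ℝ => -y ^ 2 / 2) (-x) x :=
    ((hasDerivAt_pow 2 x).neg.div_const 2).congr_deriv (by norm_num; ring)
  refine (h.exp.const_mul (Real.sqrt (2 * Real.pi))⁻¹).congr_deriv ?_
  simp only [stdGaussPdf]
  ring

theorem stdGaussPdf_le (x : ℝ) : stdGaussPdf x ≤ (Real.sqrt (2 * Real.pi))⁻¹ := by
  unfold stdGaussPdf
  refine mul_le_of_le_one_right (by positivity) (Real.exp_le_one_iff.2 ?_)
  nlinarith [sq_nonneg x]

theorem stdGaussCdf_eq_integral (x : ℝ) : stdGaussCdf x = ∫ t in Iic x, stdGaussPdf t := by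
  rw [stdGaussCdf, gaussianReal_apply_eq_integral 0 one_ne_zero,
    gaussianPDFReal_zero_one_eq_stdGaussPdf,
    ENNReal.toReal_ofReal (integral_nonneg fun t => (stdGaussPdf_pos t).le)]

theorem hasDerivAt_stdGaussCdf (x : ℝ) : HasDerivAt stdGaussCdf (stdGaussPdf x) x := by
  have h : stdGaussCdf = fun y => (∫ t in (0 : ℝ)..y, stdGaussPdf t) + stdGaussCdf 0 := by
    ext y
    rw [stdGaussCdf_eq_integral, stdGaussCdf_eq_integral,
      ← intervalIntegral.integral_Iic_sub_Iic integrable_stdGaussPdf.integrableOn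
        integrable_stdGaussPdf.integrableOn, sub_add_cancel]
  rw [h]
  exact (continuous_stdGaussPdf.integral_hasStrictDerivAt 0 x).hasDerivAt.add_const _

theorem tendsto_stdGaussCdf_atBot : Tendsto stdGaussCdf atBot (𝓝 0) := by
  refine (tendsto_cdf_atBot (gaussianReal 0 1)).congr fun x => ?_
  rw [cdf_eq_real, stdGaussCdf, measureReal_def]

/-- A Mills-ratio bound: `Φ(x) < φ(x) (-1/x - 1/x⁴)` for `x ≤ -2`. -/
theorem stdGaussCdf_lt_of_le_neg_two {x : ℝ} (hx : x ≤ -2) :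
    stdGaussCdf x < stdGaussPdf x * (-x⁻¹ - x⁻¹ ^ 4) := by
  set D : ℝ → ℝ := fun y => stdGaussPdf y * (-y⁻¹ - y⁻¹ ^ 4) - stdGaussCdf y with hD
  have hderiv (y : ℝ) (hy : y ≤ -2) :
      HasDerivAt D (stdGaussPdf y * (y⁻¹ ^ 5 * (y ^ 3 + y ^ 2 + 4))) y := by
    have hy0 : y ≠ 0 := by linarith
    refine (((hasDerivAt_stdGaussPdf y).mul
      ((hasDerivAt_inv hy0).neg.sub ((hasDerivAt_inv hy0).pow 4))).sub
        (hasDerivAt_stdGaussCdf y)).congr_deriv ?_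
    simp
    field_simp
    ring
  have hmono : StrictMonoOn D (Iic (-2)) := by
    refine strictMonoOn_of_deriv_pos (convex_Iic _)
      (fun y hy => (hderiv y hy).continuousAt.continuousWithinAt) fun y hy => ?_
    rw [interior_Iic] at hy
    have hy : y < -2 := hy
    rw [(hderiv y hy.le).deriv]
    refine mul_pos (stdGaussPdf_pos y) (mul_pos_of_neg_of_neg ?_ ?_)
    · exact Odd.pow_neg (by decide) (inv_lt_zero.2 (by linarith))
    · nlinarith [mul_pos (neg_pos.2 (by linarith : y + 2 < 0)) (by nlinarith : 0 < y ^ 2 - y + 2)]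
  have hlim : Tendsto D atBot (𝓝 0) := by
    have hinv : Tendsto (fun y : ℝ => -y⁻¹ - y⁻¹ ^ 4) atBot (𝓝 0) := by
      simpa using (tendsto_inv_atBot_zero (𝕜 := ℝ)).neg.sub (tendsto_inv_atBot_zero.pow 4)
    have hbdd : IsBoundedUnder (· ≤ ·) atBot (norm ∘ stdGaussPdf) :=
      isBoundedUnder_of ⟨_, fun y => by
        simpa [abs_of_pos (stdGaussPdf_pos y)] using stdGaussPdf_le y⟩
    simpa [hD] using (isBoundedUnder_le_mul_tendsto_zero hbdd hinv).sub tendsto_stdGaussCdf_atBot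
  have hnonneg : 0 ≤ D (x - 1) :=
    le_of_tendsto hlim <| (eventually_le_atBot (x - 1)).mono fun y hy =>
      hmono.monotoneOn (show y ≤ -2 by linarith) (show x - 1 ≤ -2 by linarith) hy
  have hlt : D (x - 1) < D x := hmono (show x - 1 ≤ -2 by linarith) hx (by linarith)
  exact sub_pos.1 (hnonneg.trans_lt hlt)

/-- Lower bound on the expected-improvement function: `f(−x) > φ(x)/x³` for all `x ≥ 2`. -/
theorem eiF_neg_gt_pdf_div_cube : ∀ x : ℝ, 2 ≤ x → stdGaussPdf x / x ^ 3 < eiF (-x) := by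
  intro x hx
  have hx0 : 0 < x := by linarith
  have h := mul_lt_mul_of_pos_left (stdGaussCdf_lt_of_le_neg_two (neg_le_neg hx)) hx0
  have heq : x * (stdGaussPdf (-x) * (-(-x)⁻¹ - (-x)⁻¹ ^ 4)) =
      stdGaussPdf x - stdGaussPdf x / x ^ 3 := by
    rw [stdGaussPdf_neg]
    field_simp
  rw [heq] at h
  rw [eiF, stdGaussPdf_neg]
  linarith
end

section
/- Let (Ω, F, P) be a probability space with a filtration (F_n)_{n≥0}. Let (d_n)_{n≥1} be a sequence of random variables such that each d_n is F_n-measurable, |d_n| ≤ 1 almost surely, and E[d_n | F_{n−1}] = 0 almost surely. Let (X_n)_{n≥1} be a sequence of {0,1}-valued random variables such that each X_n is F_{n−1}-measurable. For n ≥ 1 set S_n = Σ_{ℓ=1}^{n−1} X_ℓ and D_n = Σ_{ℓ=1}^{n−1} X_ℓ d_ℓ. Then for every x ≥ 2, P( ∃ n ≥ 1 : |D_n| ≥ x √( (1 + S_n) · log(e² + S_n) ) ) ≤ e^{−x²/2}. -/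
open MeasureTheory ProbabilityTheory Filter
open scoped ENNReal

/-- **Ville inequality**: a nonnegative supermartingale reaches level `c` at some time with
probability at most its initial expectation divided by `c`. -/
theorem MeasureTheory.Supermartingale.ville_ineq {Ω : Type*} {m0 : MeasurableSpace Ω} {P : Measure Ω}
    [IsFiniteMeasure P] {F : Filtration ℕ m0} {f : ℕ → Ω → ℝ} (hf : Supermartingale f F P)
    (hnonneg : 0 ≤ f) {c : ℝ} (hc : 0 < c) :
    P {ω | ∃ n, c ≤ f n ω} ≤ ENNReal.ofReal ((∫ ω, f 0 ω ∂P) / c) := by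
  set A : ℕ → Set Ω := fun n => {ω | ∃ k ≤ n, c ≤ f k ω} with hA
  have hAmeas : ∀ n, MeasurableSet[F n] (A n) := by
    intro n
    have : A n = ⋃ k, ⋃ (_ : k ≤ n), {ω | c ≤ f k ω} := by ext ω; simp [hA]
    rw [this]
    refine MeasurableSet.iUnion fun k => MeasurableSet.iUnion fun hk => ?_
    exact measurableSet_le measurable_const
      ((hf.stronglyAdapted k).measurable.mono (F.mono hk) le_rfl)
  have hAmeas' : ∀ n, MeasurableSet (A n) := fun n => F.le n _ (hAmeas n)
  have hAmono : Monotone A := fun m n hmn ω ⟨k, hk, h⟩ => ⟨k, hk.trans hmn, h⟩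
  have key : ∀ n, c * P.real (A n) + ∫ ω in (A n)ᶜ, f n ω ∂P ≤ ∫ ω, f 0 ω ∂P := by
    intro n
    induction n with
    | zero =>
      rw [← integral_add_compl (hAmeas' 0) (hf.integrable 0)]
      gcongr
      refine setIntegral_ge_of_const_le_real (hAmeas' 0) (measure_ne_top _ _) ?_
        (hf.integrable 0).integrableOn
      rintro ω ⟨k, hk, h⟩
      obtain rfl : k = 0 := by omega
      exact h
    | succ n ih =>
      refine le_trans ?_ ih
      have hstep := hf.setIntegral_le (Nat.le_succ n) (hAmeas n).compl
      have hdec : (A n)ᶜ = (A (n + 1))ᶜ ∪ (A (n + 1) \ A n) := by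
        ext ω
        have := @hAmono n (n + 1) (Nat.le_succ n) ω
        simp only [Set.mem_compl_iff, Set.mem_union, Set.mem_sdiff]
        tauto
      have hsplit : ∫ ω in (A n)ᶜ, f (n + 1) ω ∂P
          = ∫ ω in (A (n + 1))ᶜ, f (n + 1) ω ∂P + ∫ ω in A (n + 1) \ A n, f (n + 1) ω ∂P := by
        rw [hdec]
        exact setIntegral_union (Set.disjoint_left.2 fun ω h h' => h h'.1)
          ((hAmeas' _).diff (hAmeas' _)) (hf.integrable _).integrableOn
          (hf.integrable _).integrableOn
      have hnew : c * P.real (A (n + 1) \ A n) ≤ ∫ ω in A (n + 1) \ A n, f (n + 1) ω ∂P := by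
        refine setIntegral_ge_of_const_le_real ((hAmeas' _).diff (hAmeas' _)) (measure_ne_top _ _)
          ?_ (hf.integrable _).integrableOn
        rintro ω ⟨⟨k, hk, h⟩, hn⟩
        rcases Nat.lt_or_ge n k with hlt | hge
        · obtain rfl : k = n + 1 := by omega
          exact h
        · exact absurd ⟨k, hge, h⟩ hn
      have hdiff := measureReal_sdiff (μ := P) (hAmono (Nat.le_succ n)) (hAmeas' n)
      rw [Nat.succ_eq_add_one] at hdiff hstep
      rw [hdiff, mul_sub] at hnew
      linarith
  have hbound : ∀ n, P (A n) ≤ ENNReal.ofReal ((∫ ω, f 0 ω ∂P) / c) := by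
    intro n
    rw [← ofReal_measureReal]
    refine ENNReal.ofReal_le_ofReal ?_
    rw [le_div_iff₀ hc]
    have h0 : 0 ≤ ∫ ω in (A n)ᶜ, f n ω ∂P := integral_nonneg (hnonneg n)
    linarith [key n]
  have hUnion : {ω | ∃ n, c ≤ f n ω} = ⋃ n, A n := by
    ext ω
    simp only [Set.mem_ofPred_eq, Set.mem_iUnion, hA]
    exact ⟨fun ⟨n, h⟩ => ⟨n, n, le_rfl, h⟩, fun ⟨_, k, _, h⟩ => ⟨k, h⟩⟩
  rw [hUnion, hAmono.measure_iUnion]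
  exact iSup_le hbound

/-- The standard Gaussian mixture over `l` of the exponential weights `exp (l * y - l ^ 2 * s / 2)`,
in closed form. -/
noncomputable def gaussianMixture (s y : ℝ) : ℝ :=
  Real.exp (y ^ 2 / (2 * (1 + s))) / √(1 + s)

/-- Slope of the chord of `t ↦ gaussianMixture (s + 1) (y + t)` over `[-1, 1]`. -/
noncomputable def gaussianMixtureSlope (s y : ℝ) : ℝ :=
  (gaussianMixture (s + 1) (y + 1) - gaussianMixture (s + 1) (y - 1)) / 2

theorem gaussianMixture_nonneg (s y : ℝ) : 0 ≤ gaussianMixture s y := by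
  unfold gaussianMixture; positivity

theorem gaussianMixture_le {s y b : ℝ} (hs : 0 ≤ s) (hy : |y| ≤ b) :
    gaussianMixture s y ≤ Real.exp (b ^ 2) := by
  unfold gaussianMixture
  have h1 : 1 ≤ √(1 + s) := Real.one_le_sqrt.2 (by linarith)
  refine (div_le_self (Real.exp_pos _).le h1).trans (Real.exp_le_exp.2 ?_)
  refine (div_le_self (sq_nonneg y) (by linarith)).trans ?_
  exact sq_le_sq' (by linarith [neg_abs_le y]) ((le_abs_self y).trans hy)

theorem abs_gaussianMixtureSlope_le {s y b : ℝ} (hs : 0 ≤ s) (hy : |y| ≤ b) :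
    |gaussianMixtureSlope s y| ≤ Real.exp ((b + 1) ^ 2) := by
  have hp : |y + 1| ≤ b + 1 := (abs_add_le _ _).trans (by simpa using hy)
  have hm : |y - 1| ≤ b + 1 := (abs_sub _ _).trans (by simpa using hy)
  have h1 := gaussianMixture_le (by linarith : 0 ≤ s + 1) hp
  have h2 := gaussianMixture_le (by linarith : 0 ≤ s + 1) hm
  have h3 := gaussianMixture_nonneg (s + 1) (y + 1)
  have h4 := gaussianMixture_nonneg (s + 1) (y - 1)
  unfold gaussianMixtureSlope
  rw [abs_le]
  constructor <;> linarith

theorem measurable_gaussianMixture {Ω : Type*} {m : MeasurableSpace Ω} {s y : Ω → ℝ}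
    (hs : Measurable s) (hy : Measurable y) : Measurable fun ω => gaussianMixture (s ω) (y ω) := by
  unfold gaussianMixture; fun_prop

theorem measurable_gaussianMixtureSlope {Ω : Type*} {m : MeasurableSpace Ω} {s y : Ω → ℝ}
    (hs : Measurable s) (hy : Measurable y) :
    Measurable fun ω => gaussianMixtureSlope (s ω) (y ω) := by
  unfold gaussianMixtureSlope
  exact ((measurable_gaussianMixture (hs.add_const 1) (hy.add_const 1)).sub
    (measurable_gaussianMixture (hs.add_const 1) (hy.sub_const 1))).div_const 2

theorem convexOn_gaussianMixture {s : ℝ} (hs : 0 ≤ s) :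
    ConvexOn ℝ Set.univ (gaussianMixture s) := by
  have hsq : ConvexOn ℝ Set.univ fun y : ℝ => y ^ 2 := Even.convexOn_pow even_two
  have h1 : ConvexOn ℝ Set.univ fun y : ℝ => y ^ 2 / (2 * (1 + s)) := by
    have := hsq.smul (c := (2 * (1 + s))⁻¹) (by positivity)
    simpa [div_eq_inv_mul] using this
  have h2 : ConvexOn ℝ Set.univ fun y : ℝ => Real.exp (y ^ 2 / (2 * (1 + s))) := by
    refine ⟨convex_univ, fun x _ y _ a b ha hb hab => ?_⟩
    exact (Real.exp_le_exp.2 (h1.2 trivial trivial ha hb hab)).trans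
      (convexOn_exp.2 trivial trivial ha hb hab)
  refine (h2.smul (c := (√(1 + s))⁻¹) (by positivity)).congr fun y _ => ?_
  exact inv_mul_eq_div _ _

/-- A symmetric `±1` step does not increase the mixture on average. -/
theorem gaussianMixture_add_gaussianMixture_le {s : ℝ} (hs : 0 ≤ s) (y : ℝ) :
    gaussianMixture (s + 1) (y + 1) + gaussianMixture (s + 1) (y - 1) ≤
      2 * gaussianMixture s y := by
  have hs1 : 0 < 1 + s := by linarith
  have hs2 : 0 < 2 + s := by linarith
  have hsum : gaussianMixture (s + 1) (y + 1) + gaussianMixture (s + 1) (y - 1)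
      = 2 * (Real.exp ((y ^ 2 + 1) / (2 * (2 + s))) * Real.cosh (y / (2 + s)) / √(2 + s)) := by
    unfold gaussianMixture
    rw [Real.cosh_eq, show 1 + (s + 1) = 2 + s by ring,
      show (y + 1) ^ 2 / (2 * (2 + s)) = (y ^ 2 + 1) / (2 * (2 + s)) + y / (2 + s) by
        field_simp; ring,
      show (y - 1) ^ 2 / (2 * (2 + s)) = (y ^ 2 + 1) / (2 * (2 + s)) + -(y / (2 + s)) by
        field_simp; ring, Real.exp_add, Real.exp_add]
    ring
  have hsqrt : ∀ a : ℝ, 0 < a → √a = Real.exp (Real.log a / 2) := fun a ha => by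
    rw [Real.exp_half, Real.exp_log ha]
  have hlog : 1 / (2 + s) ≤ Real.log (2 + s) - Real.log (1 + s) := by
    have h := Real.log_le_sub_one_of_pos (div_pos hs1 hs2)
    rw [Real.log_div hs1.ne' hs2.ne'] at h
    have : (1 + s) / (2 + s) - 1 = -(1 / (2 + s)) := by field_simp; ring
    linarith
  have hquad : y ^ 2 / (2 * (2 + s)) + (y / (2 + s)) ^ 2 / 2 ≤ y ^ 2 / (2 * (1 + s)) := by
    have : y ^ 2 / (2 * (1 + s)) - (y ^ 2 / (2 * (2 + s)) + (y / (2 + s)) ^ 2 / 2)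
        = y ^ 2 / (2 * (1 + s) * (2 + s) ^ 2) := by field_simp; ring
    have h0 : 0 ≤ y ^ 2 / (2 * (1 + s) * (2 + s) ^ 2) := by positivity
    linarith
  rw [hsum]
  gcongr
  calc Real.exp ((y ^ 2 + 1) / (2 * (2 + s))) * Real.cosh (y / (2 + s)) / √(2 + s)
      ≤ Real.exp ((y ^ 2 + 1) / (2 * (2 + s))) * Real.exp ((y / (2 + s)) ^ 2 / 2) / √(2 + s) := by
        gcongr; exact Real.cosh_le_exp_half_sq _
    _ ≤ gaussianMixture s y := by
        unfold gaussianMixture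
        rw [hsqrt _ hs1, hsqrt _ hs2, ← Real.exp_add, ← Real.exp_sub, ← Real.exp_sub,
          Real.exp_le_exp]
        have : (y ^ 2 + 1) / (2 * (2 + s)) = y ^ 2 / (2 * (2 + s)) + 1 / (2 + s) / 2 := by
          field_simp
        linarith

theorem gaussianMixture_succ_le {s t : ℝ} (hs : 0 ≤ s) (ht : |t| ≤ 1) (y : ℝ) :
    gaussianMixture (s + 1) (y + t) ≤ gaussianMixture s y + gaussianMixtureSlope s y * t := by
  obtain ⟨h1, h2⟩ := abs_le.1 ht
  have hconv := (convexOn_gaussianMixture (by linarith : 0 ≤ s + 1)).2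
    (Set.mem_univ (y + 1)) (Set.mem_univ (y - 1)) (by linarith : 0 ≤ (1 + t) / 2)
    (by linarith : 0 ≤ (1 - t) / 2) (by ring)
  simp only [smul_eq_mul] at hconv
  rw [show (1 + t) / 2 * (y + 1) + (1 - t) / 2 * (y - 1) = y + t by ring] at hconv
  unfold gaussianMixtureSlope
  linarith [gaussianMixture_add_gaussianMixture_le hs y]

theorem exp_half_sq_le_gaussianMixture {s y x : ℝ} (hs : 0 ≤ s) (hx : 2 ≤ x)
    (h : x * √((1 + s) * Real.log (Real.exp 1 ^ 2 + s)) ≤ |y|) :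
    Real.exp (x ^ 2 / 2) ≤ gaussianMixture s y := by
  have hs1 : 0 < 1 + s := by linarith
  have he : 1 ≤ Real.exp 1 ^ 2 := one_le_pow₀ (Real.one_le_exp zero_le_one)
  set L := Real.log (Real.exp 1 ^ 2 + s) with hL
  have hL2 : 2 ≤ L := by
    have : Real.log (Real.exp 1 ^ 2) ≤ L := Real.log_le_log (by positivity) (by linarith)
    simpa using this
  have hLs : Real.log (1 + s) ≤ L := Real.log_le_log hs1 (by linarith)
  have hsq : x ^ 2 * ((1 + s) * L) ≤ y ^ 2 := by
    have := pow_le_pow_left₀ (by positivity) h 2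
    rwa [mul_pow, Real.sq_sqrt (by positivity), sq_abs] at this
  have hdiv : x ^ 2 * L / 2 ≤ y ^ 2 / (2 * (1 + s)) := by
    rw [le_div_iff₀ (by positivity)]
    linarith
  unfold gaussianMixture
  have hsqrt : √(1 + s) = Real.exp (Real.log (1 + s) / 2) := by
    rw [Real.exp_half, Real.exp_log hs1]
  rw [hsqrt, ← Real.exp_sub, Real.exp_le_exp]
  nlinarith [mul_le_mul (by nlinarith : (4 : ℝ) ≤ x ^ 2) (by linarith : L / 2 ≤ L - 1)
    (by linarith) (by positivity)]

/-- The Gaussian mixture of a martingale transform with bounded increments, evaluated at its number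
of active steps, is a supermartingale. -/
theorem supermartingale_gaussianMixture {Ω : Type*} {m0 : MeasurableSpace Ω}
    (P : Measure Ω) [IsProbabilityMeasure P] (F : Filtration ℕ m0)
    (d X : ℕ → Ω → ℝ)
    (hd_meas : ∀ n : ℕ, 1 ≤ n → Measurable[F n] (d n))
    (hd_bdd : ∀ n : ℕ, 1 ≤ n → ∀ᵐ ω ∂P, |d n ω| ≤ 1)
    (hd_mean : ∀ n : ℕ, 1 ≤ n → P[d n|F (n - 1)] =ᵐ[P] 0)
    (hX01 : ∀ n ω, X n ω = 0 ∨ X n ω = 1)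
    (hX_meas : ∀ n : ℕ, 1 ≤ n → Measurable[F (n - 1)] (X n)) :
    Supermartingale (fun n ω => gaussianMixture (∑ ℓ ∈ Finset.Ico 1 (n + 1), X ℓ ω)
      (∑ ℓ ∈ Finset.Ico 1 (n + 1), X ℓ ω * d ℓ ω)) F P := by
  set S : ℕ → Ω → ℝ := fun n ω => ∑ ℓ ∈ Finset.Ico 1 (n + 1), X ℓ ω with hS
  set D : ℕ → Ω → ℝ := fun n ω => ∑ ℓ ∈ Finset.Ico 1 (n + 1), X ℓ ω * d ℓ ω with hD
  have hS_meas : ∀ n, Measurable[F n] (S n) := fun n =>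
    Finset.measurable_fun_sum _ fun ℓ hℓ => by
      rw [Finset.mem_Ico] at hℓ
      exact (hX_meas ℓ hℓ.1).mono (F.mono (by omega)) le_rfl
  have hD_meas : ∀ n, Measurable[F n] (D n) := fun n =>
    Finset.measurable_fun_sum _ fun ℓ hℓ => by
      rw [Finset.mem_Ico] at hℓ
      exact ((hX_meas ℓ hℓ.1).mono (F.mono (by omega)) le_rfl).mul
        ((hd_meas ℓ hℓ.1).mono (F.mono (by omega)) le_rfl)
  have hX_nonneg : ∀ n ω, 0 ≤ X n ω := fun n ω => by rcases hX01 n ω with h | h <;> simp [h]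
  have hX_abs : ∀ n ω, |X n ω| ≤ 1 := fun n ω => by rcases hX01 n ω with h | h <;> simp [h]
  have hS_nonneg : ∀ n ω, 0 ≤ S n ω := fun n ω => Finset.sum_nonneg fun ℓ _ => hX_nonneg ℓ ω
  have hS_succ : ∀ n ω, S (n + 1) ω = S n ω + X (n + 1) ω := fun n ω =>
    Finset.sum_Ico_succ_top (by omega) _
  have hD_succ : ∀ n ω, D (n + 1) ω = D n ω + X (n + 1) ω * d (n + 1) ω := fun n ω =>
    Finset.sum_Ico_succ_top (by omega) _
  have hD_bdd : ∀ n, ∀ᵐ ω ∂P, |D n ω| ≤ n := by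
    intro n
    induction n with
    | zero => simp [hD]
    | succ n ih =>
      filter_upwards [ih, hd_bdd (n + 1) (by omega)] with ω h1 h2
      rw [hD_succ]
      refine (abs_add_le _ _).trans ?_
      rw [abs_mul]
      push_cast
      exact add_le_add h1 (mul_le_one₀ (hX_abs _ _) (abs_nonneg _) h2)
  set W : ℕ → Ω → ℝ := fun n ω => gaussianMixture (S n ω) (D n ω) with hW
  have hW_meas : ∀ n, Measurable[F n] (W n) := fun n =>
    measurable_gaussianMixture (hS_meas n) (hD_meas n)
  have hW_int : ∀ n, Integrable (W n) P := fun n => by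
    refine Integrable.of_bound ((hW_meas n).mono (F.le n) le_rfl).aestronglyMeasurable
      (Real.exp ((n : ℝ) ^ 2)) ?_
    filter_upwards [hD_bdd n] with ω h
    rw [Real.norm_of_nonneg (gaussianMixture_nonneg _ _)]
    exact gaussianMixture_le (hS_nonneg n ω) h
  refine supermartingale_nat (fun n => (hW_meas n).stronglyMeasurable) hW_int fun n => ?_
  set H : Ω → ℝ := fun ω => X (n + 1) ω * gaussianMixtureSlope (S n ω) (D n ω) with hH
  have hH_meas : Measurable[F n] H :=
    Measurable.mul (hX_meas (n + 1) (by omega))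
      (measurable_gaussianMixtureSlope (hS_meas n) (hD_meas n))
  have hH_bdd : ∀ᵐ ω ∂P, ‖H ω‖ ≤ Real.exp (((n : ℝ) + 1) ^ 2) := by
    filter_upwards [hD_bdd n] with ω h
    rw [Real.norm_eq_abs, abs_mul]
    exact (mul_le_of_le_one_left (abs_nonneg _) (hX_abs _ _)).trans
      (abs_gaussianMixtureSlope_le (hS_nonneg n ω) h)
  have hd_int : Integrable (d (n + 1)) P :=
    Integrable.of_bound
      ((hd_meas (n + 1) (by omega)).mono (F.le _) le_rfl).aestronglyMeasurable 1
      (hd_bdd (n + 1) (by omega))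
  have hHd_int : Integrable (H * d (n + 1)) P :=
    hd_int.bdd_mul (hH_meas.mono (F.le n) le_rfl).aestronglyMeasurable hH_bdd
  have hle : W (n + 1) ≤ᵐ[P] W n + H * d (n + 1) := by
    filter_upwards [hd_bdd (n + 1) (by omega)] with ω h
    simp only [hW, hH, Pi.add_apply, Pi.mul_apply, hS_succ, hD_succ]
    rcases hX01 (n + 1) ω with h0 | h1
    · simp [h0]
    · simpa [h1] using gaussianMixture_succ_le (hS_nonneg n ω) h (D n ω)
  have hpull := condExp_stronglyMeasurable_mul_of_bound (F.le n) hH_meas.stronglyMeasurable hd_int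
    _ hH_bdd
  have hmono := condExp_mono (m := F n) (hW_int (n + 1)) ((hW_int n).add hHd_int) hle
  have hadd := condExp_add (hW_int n) hHd_int (F n)
  have hself := condExp_of_stronglyMeasurable (F.le n) (hW_meas n).stronglyMeasurable (hW_int n)
  filter_upwards [hmono, hadd, hpull, hd_mean (n + 1) (by omega)] with ω h1 h2 h3 h4
  rw [Nat.add_sub_cancel] at h4
  rw [h2, Pi.add_apply, hself, h3, Pi.mul_apply, h4] at h1
  simpa using h1

/-- Uniform self-normalized martingale deviation bound: if `(d n)` are martingale-difference
increments bounded by `1` (each `d n` is `F n`-measurable with `E[d n | F (n−1)] = 0`), and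
`(X n)` is a `{0,1}`-valued previsible process, then with `S n = Σ_{ℓ=1}^{n−1} X ℓ` and
`D n = Σ_{ℓ=1}^{n−1} X ℓ d ℓ`, for every `x ≥ 2`,
`P(∃ n ≥ 1, |D n| ≥ x √((1 + S n) log(e² + S n))) ≤ e^{−x²/2}`. -/
theorem self_normalized_martingale_bound {Ω : Type*} {m0 : MeasurableSpace Ω}
    (P : Measure Ω) [IsProbabilityMeasure P] (F : Filtration ℕ m0)
    (d X : ℕ → Ω → ℝ)
    (hd_meas : ∀ n : ℕ, 1 ≤ n → Measurable[F n] (d n))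
    (hd_bdd : ∀ n : ℕ, 1 ≤ n → ∀ᵐ ω ∂P, |d n ω| ≤ 1)
    (hd_mean : ∀ n : ℕ, 1 ≤ n → P[d n|F (n - 1)] =ᵐ[P] 0)
    (hX01 : ∀ n ω, X n ω = 0 ∨ X n ω = 1)
    (hX_meas : ∀ n : ℕ, 1 ≤ n → Measurable[F (n - 1)] (X n)) :
    ∀ x : ℝ, 2 ≤ x →
      P {ω | ∃ n : ℕ, 1 ≤ n ∧
          x * Real.sqrt ((1 + ∑ ℓ ∈ Finset.Ico 1 n, X ℓ ω) *
              Real.log (Real.exp 1 ^ 2 + ∑ ℓ ∈ Finset.Ico 1 n, X ℓ ω))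
            ≤ |∑ ℓ ∈ Finset.Ico 1 n, X ℓ ω * d ℓ ω|}
        ≤ ENNReal.ofReal (Real.exp (-x ^ 2 / 2)) := by
  intro x hx
  have hsuper := supermartingale_gaussianMixture P F d X hd_meas hd_bdd hd_mean hX01 hX_meas
  have hville := hsuper.ville_ineq (fun n ω => gaussianMixture_nonneg _ _)
    (Real.exp_pos (x ^ 2 / 2))
  refine (measure_mono ?_).trans (hville.trans_eq ?_)
  · rintro ω ⟨n, hn, h⟩
    obtain ⟨k, rfl⟩ : ∃ k, n = k + 1 := ⟨n - 1, by omega⟩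
    refine ⟨k, exp_half_sq_le_gaussianMixture (Finset.sum_nonneg fun ℓ _ => ?_) hx h⟩
    rcases hX01 ℓ ω with h | h <;> simp [h]
  · simp [gaussianMixture, neg_div, Real.exp_neg]
end
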